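/- For any real matrices M1 (of size N₁×N₂) and M2 (of size N₃×N₄), and any 0 < p ≤ ∞ and 0 < q ≤ ∞, the (p,q) group norm is multiplicative with respect to the Kronecker (tensor) product: ‖M1 ⊗ M2‖_{p,q} = ‖M1‖_{p,q} · ‖M2‖_{p,q}, where M1 ⊗ M2 is the (N₁N₃)×(N₂N₄) Kronecker product with entries [M1 ⊗ M2]_{(i,i'),(j,j')} = [M1]_{i,j}·[M2]_{i',j'}. -/

import Mathlib

open scoped ENNReal BigOperators
open Matrix

/-- The `l_p` norm of a finitely-indexed real vector, for `0 < p ≤ ∞`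
(for `p = ∞` it is the max of the absolute values of the entries). -/
noncomputable def vecLpNorm {ι : Type*} [Fintype ι] (p : ℝ≥0∞) (w : ι → ℝ) : ℝ :=
  if p = ∞ then ⨆ j, |w j| else (∑ j, |w j| ^ p.toReal) ^ (1 / p.toReal)

/-- The `(p,q)` group norm of a real matrix:
`‖M‖_{p,q} = ((1/N₁) ∑_i ‖M_i‖_p^q)^{1/q}`, with `‖M‖_{p,∞} = max_i ‖M_i‖_p`. -/
noncomputable def groupNorm {ι κ : Type*} [Fintype ι] [Fintype κ]
    (p q : ℝ≥0∞) (M : Matrix ι κ ℝ) : ℝ :=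
  if q = ∞ then ⨆ i, vecLpNorm p (M i)
  else ((Fintype.card ι : ℝ)⁻¹ * ∑ i, vecLpNorm p (M i) ^ q.toReal) ^ (1 / q.toReal)

open scoped Kronecker

/-- For finite families of nonnegative reals, the supremum of the products is the product of the
suprema (also over empty index types, where both sides are `0`). -/
theorem Real.iSup_prod_mul_of_nonneg {ι κ : Type*} [Finite ι] [Finite κ] {f : ι → ℝ} {g : κ → ℝ}
    (hf : ∀ i, 0 ≤ f i) (hg : ∀ j, 0 ≤ g j) :
    ⨆ x : ι × κ, f x.1 * g x.2 = (⨆ i, f i) * ⨆ j, g j := by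
  apply le_antisymm
  · refine Real.iSup_le (fun x => ?_) (mul_nonneg (Real.iSup_nonneg hf) (Real.iSup_nonneg hg))
    exact mul_le_mul (le_ciSup (Set.finite_range f).bddAbove x.1)
      (le_ciSup (Set.finite_range g).bddAbove x.2) (hg _) (Real.iSup_nonneg hf)
  · have hfg : 0 ≤ ⨆ x : ι × κ, f x.1 * g x.2 :=
      Real.iSup_nonneg fun x => mul_nonneg (hf _) (hg _)
    rw [Real.iSup_mul_of_nonneg (Real.iSup_nonneg hg)]
    refine Real.iSup_le (fun i => ?_) hfg
    rw [Real.mul_iSup_of_nonneg (hf i)]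
    exact Real.iSup_le (fun j => le_ciSup (f := fun x : ι × κ => f x.1 * g x.2)
      (Set.finite_range _).bddAbove (i, j)) hfg

theorem vecLpNorm_nonneg {ι : Type*} [Fintype ι] (p : ℝ≥0∞) (w : ι → ℝ) : 0 ≤ vecLpNorm p w := by
  unfold vecLpNorm
  split_ifs
  · exact Real.iSup_nonneg fun j => abs_nonneg _
  · positivity

theorem vecLpNorm_prod_mul {ι κ : Type*} [Fintype ι] [Fintype κ] (p : ℝ≥0∞)
    (v : ι → ℝ) (w : κ → ℝ) :
    vecLpNorm p (fun x : ι × κ => v x.1 * w x.2) = vecLpNorm p v * vecLpNorm p w := by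
  unfold vecLpNorm
  split_ifs
  · simp only [abs_mul]
    exact Real.iSup_prod_mul_of_nonneg (fun i => abs_nonneg (v i)) fun j => abs_nonneg (w j)
  · rw [← Real.mul_rpow (by positivity) (by positivity), Fintype.sum_mul_sum,
      Fintype.sum_prod_type]
    simp only [abs_mul, Real.mul_rpow (abs_nonneg _) (abs_nonneg _)]

theorem groupNorm_kronecker {l m n o : Type*} [Fintype l] [Fintype m] [Fintype n] [Fintype o]
    (p q : ℝ≥0∞) (A : Matrix l m ℝ) (B : Matrix n o ℝ) :
    groupNorm p q (A ⊗ₖ B) = groupNorm p q A * groupNorm p q B := by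
  have hrow (x : l × n) :
      vecLpNorm p ((A ⊗ₖ B) x) = vecLpNorm p (A x.1) * vecLpNorm p (B x.2) :=
    vecLpNorm_prod_mul p (A x.1) (B x.2)
  unfold groupNorm
  simp only [hrow]
  split_ifs
  · exact Real.iSup_prod_mul_of_nonneg (fun i => vecLpNorm_nonneg p (A i))
      fun i => vecLpNorm_nonneg p (B i)
  · have hA : 0 ≤ ∑ i, vecLpNorm p (A i) ^ q.toReal :=
      Finset.sum_nonneg fun i _ => Real.rpow_nonneg (vecLpNorm_nonneg p _) _
    have hB : 0 ≤ ∑ i, vecLpNorm p (B i) ^ q.toReal :=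
      Finset.sum_nonneg fun i _ => Real.rpow_nonneg (vecLpNorm_nonneg p _) _
    rw [← Real.mul_rpow (by positivity) (by positivity), mul_mul_mul_comm, Fintype.sum_mul_sum,
      Fintype.sum_prod_type, Fintype.card_prod, Nat.cast_mul, mul_inv]
    simp only [Real.mul_rpow (vecLpNorm_nonneg p _) (vecLpNorm_nonneg p _)]

/-- The `(p,q)` group norm is multiplicative with respect to the Kronecker product. -/
theorem statement7 (N₁ N₂ N₃ N₄ : ℕ)
    (M1 : Matrix (Fin N₁) (Fin N₂) ℝ) (M2 : Matrix (Fin N₃) (Fin N₄) ℝ)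
    (p q : ℝ≥0∞) (hp : 0 < p) (hq : 0 < q) :
    groupNorm p q (M1 ⊗ₖ M2) = groupNorm p q M1 * groupNorm p q M2 := by
  exact groupNorm_kronecker p q M1 M2
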